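/- Let A = {a_1 < a_2 < ⋯ < a_{2k}} be a 2k-clique of 𝒢 and let w_A = $·(1 2⋯N)·#·a_1·#·(1 2⋯N)·#·a_2·#·⋯·#·a_{2k}·#·(1 2⋯N)·$. Then w_A belongs to 𝒟₀* (i.e., w_A can be partitioned into words from 𝒟₀) if and only if there exists a k-clique B of 𝒢 with A ∩ B = ∅ such that every vertex of A is adjacent to every vertex of B (equivalently, A ∪ B is a 3k-clique of 𝒢). -/

import Mathlib

/-- The alphabet `Σ = {1,…,N} ∪ {$, #, γ, μ, α, β}`: numeric symbols together
with six distinct special symbols. -/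
inductive Letter where
  | num : ℕ → Letter
  | dollar : Letter
  | hash : Letter
  | gam : Letter
  | mu : Letter
  | alp : Letter
  | bet : Letter
deriving DecidableEq

/-- The string of numeric symbols `a·(a+1)⋯(a+len−1)`. -/
def nums (a len : ℕ) : List Letter := (List.range len).map (fun t => Letter.num (a + t))

/-- `Low(b) = 1·2⋯(b−1)` (empty if `b = 1`). -/
def low (b : ℕ) : List Letter := nums 1 (b - 1)

/-- `High(b) = b·(b+1)⋯N`. -/
def high (N b : ℕ) : List Letter := nums b (N + 1 - b)

/-- The string `1·2⋯N`. -/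
def full (N : ℕ) : List Letter := nums 1 N

/-- For a `2k`-clique `A = {a_1 < ⋯ < a_{2k}}`, the gadget string
`w_A = $·(1 2⋯N)·#·a_1·#·(1 2⋯N)·#·a_2·#·⋯·#·a_{2k}·#·(1 2⋯N)·$`.
A vertex `a : Fin n` is written as the numeric symbol `a+1 ∈ {1,…,n}`. -/
def wordA (n N : ℕ) (A : Finset (Fin n)) : List Letter :=
  Letter.dollar :: (full N ++
    (A.sort (· ≤ ·)).flatMap (fun a => Letter.hash :: Letter.num (a.val + 1) :: Letter.hash :: full N) ++
    [Letter.dollar])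

/-- `s` belongs to the Kleene star of the dictionary `D`:
`s` is a concatenation of finitely many (possibly zero) words of `D`. -/
def InStar (D : Set (List Letter)) (s : List Letter) : Prop :=
  ∃ fs : List (List Letter), (∀ f ∈ fs, f ∈ D) ∧ fs.flatten = s

/-- The dictionary `𝒟₀`: for every `k`-clique `B` with `b = code B`,
the words `$·Low(b)` and `High(b)·$`; and for every `k`-clique `B` and every
vertex `i ∉ B` adjacent to every vertex of `B`, the word `High(b)·#·i·#·Low(b)`. -/
def dict0 (n k N : ℕ) (G : SimpleGraph (Fin n)) (code : Finset (Fin n) → ℕ) :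
    Set (List Letter) :=
  {w | ∃ B : Finset (Fin n), G.IsNClique k B ∧
        (w = Letter.dollar :: low (code B) ∨
         w = high N (code B) ++ [Letter.dollar] ∨
         ∃ i : Fin n, i ∉ B ∧ (∀ v ∈ B, G.Adj i v) ∧
           w = high N (code B) ++
               Letter.hash :: Letter.num (i.val + 1) :: Letter.hash :: low (code B))}

theorem low_append_high {N b : ℕ} (h1 : 1 ≤ b) (h2 : b ≤ N) : low b ++ high N b = full N := by
  obtain ⟨c, rfl⟩ := Nat.exists_eq_add_of_le' h1
  obtain ⟨d, rfl⟩ := Nat.exists_eq_add_of_le h2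
  have e1 : c + 1 + d + 1 - (c + 1) = d + 1 := by omega
  have e2 : c + 1 + d = c + (d + 1) := by omega
  unfold low high full nums
  rw [e1, e2]
  generalize d + 1 = e
  rw [List.range_add, List.map_append, List.map_map]
  simp only [Nat.add_sub_cancel]
  congr 1
  apply List.map_congr_left
  intro t _
  simp only [Function.comp, Letter.num.injEq]
  omega

theorem high_eq_cons {N b : ℕ} (h : b ≤ N) :
    high N b = Letter.num b :: nums (b + 1) (N - b) := by
  have e : N + 1 - b = (N - b) + 1 := by omega
  unfold high nums
  rw [e, List.range_succ_eq_map, List.map_cons, List.map_map]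
  simp only [Nat.add_zero]
  congr 1
  apply List.map_congr_left
  intro t _
  simp only [Function.comp, Letter.num.injEq]
  omega

theorem inStar_append {D : Set (List Letter)} {u s : List Letter} (hu : u ∈ D)
    (hs : InStar D s) : InStar D (u ++ s) := by
  obtain ⟨fs, hfs, rfl⟩ := hs
  exact ⟨u :: fs, List.forall_mem_cons.2 ⟨hu, hfs⟩, rfl⟩

theorem InStar.exists_append {D : Set (List Letter)} {s : List Letter} (hs : InStar D s)
    (hne : s ≠ []) : ∃ u ∈ D, ∃ t, InStar D t ∧ u ++ t = s := by
  obtain ⟨fs, hfs, rfl⟩ := hs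
  cases fs with
  | nil => exact absurd rfl hne
  | cons u fs =>
    rw [List.forall_mem_cons] at hfs
    exact ⟨u, hfs.1, fs.flatten, ⟨fs, hfs.2, rfl⟩, rfl⟩

/-- The part of the gadget string following `#·a·#·(1 2⋯N)`, for the remaining vertices `l`. -/
def gadgetTail (n N : ℕ) (l : List (Fin n)) : List Letter :=
  l.flatMap (fun a => Letter.hash :: Letter.num (a.val + 1) :: Letter.hash :: full N) ++
    [Letter.dollar]

theorem gadgetTail_cons (n N : ℕ) (a : Fin n) (l : List (Fin n)) :
    gadgetTail n N (a :: l) =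
      Letter.hash :: Letter.num (a.val + 1) :: Letter.hash :: (full N ++ gadgetTail n N l) := by
  simp [gadgetTail]

theorem inStar_high_append_gadgetTail {k n N : ℕ} {G : SimpleGraph (Fin n)}
    {code : Finset (Fin n) → ℕ}
    (hrange : ∀ B : Finset (Fin n), G.IsNClique k B → 1 ≤ code B ∧ code B ≤ N)
    (hinj : ∀ B C : Finset (Fin n),
      G.IsNClique k B → G.IsNClique k C → code B = code C → B = C)
    {B : Finset (Fin n)} (hB : G.IsNClique k B) (l : List (Fin n)) :
    InStar (dict0 n k N G code) (high N (code B) ++ gadgetTail n N l) ↔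
      ∀ a ∈ l, ∀ b ∈ B, G.Adj a b := by
  induction l with
  | nil =>
    refine iff_of_true ⟨[high N (code B) ++ [Letter.dollar]], ?_, by simp [gadgetTail]⟩ (by simp)
    simp only [List.mem_singleton, forall_eq]
    exact ⟨B, hB, Or.inr (Or.inl rfl)⟩
  | cons a l ih =>
    have hsplit : high N (code B) ++ gadgetTail n N (a :: l) =
        (high N (code B) ++
          Letter.hash :: Letter.num (a.val + 1) :: Letter.hash :: low (code B)) ++
          (high N (code B) ++ gadgetTail n N l) := by
      rw [gadgetTail_cons, ← low_append_high (hrange B hB).1 (hrange B hB).2]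
      simp
    rw [List.forall_mem_cons]
    constructor
    · intro h
      obtain ⟨u, ⟨C, hC, hu⟩, t, ht, heq⟩ := h.exists_append (by
        rw [high_eq_cons (hrange B hB).2]; simp)
      have hcode : ∀ s s', high N (code C) ++ s = high N (code B) ++ s' → C = B := by
        intro s s' hs
        rw [high_eq_cons (hrange B hB).2, high_eq_cons (hrange C hC).2] at hs
        simp only [List.cons_append, List.cons.injEq, Letter.num.injEq] at hs
        exact hinj C B hC hB hs.1
      rcases hu with rfl | rfl | ⟨i, -, hi, rfl⟩
      · rw [high_eq_cons (hrange B hB).2] at heq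
        simp at heq
      · rw [List.append_assoc] at heq
        obtain rfl := hcode _ _ heq
        rw [List.append_cancel_left_eq, gadgetTail_cons] at heq
        simp at heq
      · have heq' := heq
        rw [List.append_assoc] at heq'
        obtain rfl := hcode _ _ heq'
        rw [List.append_cancel_left_eq, gadgetTail_cons] at heq'
        simp only [List.cons_append, List.cons.injEq, Letter.num.injEq, true_and] at heq'
        obtain rfl : i = a := Fin.ext (by omega)
        rw [hsplit, List.append_cancel_left_eq] at heq
        exact ⟨hi, ih.1 (heq ▸ ht)⟩
    · rintro ⟨ha, hl⟩
      rw [hsplit]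
      exact inStar_append
        ⟨B, hB, Or.inr (Or.inr ⟨a, fun h => G.irrefl (ha a h), ha, rfl⟩)⟩ (ih.2 hl)

theorem stmt5 (k n : ℕ) (hk : 1 ≤ k) (hn : 1 ≤ n)
    (G : SimpleGraph (Fin n)) (code : Finset (Fin n) → ℕ)
    (hcode_range : ∀ B : Finset (Fin n), G.IsNClique k B → 1 ≤ code B ∧ code B ≤ n ^ k)
    (hcode_inj : ∀ B C : Finset (Fin n),
      G.IsNClique k B → G.IsNClique k C → code B = code C → B = C)
    (A : Finset (Fin n)) (hA : G.IsNClique (2 * k) A) :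
    InStar (dict0 n k (n ^ k) G code) (wordA n (n ^ k) A) ↔
      ∃ B : Finset (Fin n), G.IsNClique k B ∧ Disjoint A B ∧
        ∀ a ∈ A, ∀ b ∈ B, G.Adj a b := by
  have hsplit : ∀ B, G.IsNClique k B → wordA n (n ^ k) A =
      (Letter.dollar :: low (code B)) ++
        (high (n ^ k) (code B) ++ gadgetTail n (n ^ k) (A.sort (· ≤ ·))) := by
    intro B hB
    have hfull := low_append_high (hcode_range B hB).1 (hcode_range B hB).2
    rw [List.cons_append, ← List.append_assoc, hfull, wordA, gadgetTail, List.append_assoc]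
  constructor
  · intro h
    obtain ⟨u, ⟨B, hB, hu⟩, t, ht, heq⟩ := h.exists_append (by simp [wordA])
    rcases hu with rfl | rfl | ⟨i, -, -, rfl⟩
    · rw [hsplit B hB, List.append_cancel_left_eq] at heq
      subst heq
      have hadj := (inStar_high_append_gadgetTail hcode_range hcode_inj hB _).1 ht
      simp only [Finset.mem_sort] at hadj
      exact ⟨B, hB, Finset.disjoint_left.2 fun a ha hb => G.irrefl (hadj a ha a hb), hadj⟩
    all_goals
      rw [high_eq_cons (hcode_range B hB).2] at heq
      simp [wordA] at heq
  · rintro ⟨B, hB, -, hadj⟩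
    rw [hsplit B hB]
    refine inStar_append ⟨B, hB, Or.inl rfl⟩
      ((inStar_high_append_gadgetTail hcode_range hcode_inj hB _).2 ?_)
    simpa only [Finset.mem_sort] using hadj
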